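/- Let α > 0 be an integer, n ∈ ℕ and k ∈ {1,…,n}. (a) If α is even, then 𝐈̃_{n,k}(α) is rational. (b) If α is odd, then there exist rational numbers r_0, r_2, r_4, … such that 𝐈̃_{n,k}(α) = r_0 + r_2·π^{−2} + r_4·π^{−4} + … + r_{n−k}·π^{−(n−k)} if n−k is even, and 𝐈̃_{n,k}(α) = r_0 + r_2·π^{−2} + r_4·π^{−4} + … + r_{n−k−1}·π^{−(n−k−1)} if n−k is odd. -/

import Mathlib

open MeasureTheory Real

noncomputable section

/-- Normalizing constant of the one-dimensional beta' density. -/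
def c1t (β : ℝ) : ℝ := Real.Gamma β / (Real.sqrt Real.pi * Real.Gamma (β - 1 / 2))

/-- The quantity `Ĩ_{n,k}(α)`. -/
def It (n k : ℕ) (α : ℝ) : ℝ :=
  ∫ φ in (-(Real.pi / 2))..(Real.pi / 2),
    c1t ((α * k + 1) / 2) * Real.cos φ ^ (α * k - 1) *
      (∫ θ in (-(Real.pi / 2))..φ, c1t ((α + 1) / 2) * Real.cos θ ^ (α - 1)) ^ (n - k)

/-- `Itb n k α = binom(n,k) * It n k α`, the expected external angle sum `𝐈̃_{n,k}(α)`. -/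
def Itb (n k : ℕ) (α : ℝ) : ℝ := (n.choose k : ℝ) * It n k α

/-- The `ℚ`-span of `1, π⁻², …, π⁻²ᵈ`. -/
def invPiSqSpan (d : ℕ) : Submodule ℚ ℝ :=
  Submodule.span ℚ ((fun j : ℕ => ((π ^ 2)⁻¹) ^ j) '' (Finset.range (d + 1) : Set ℕ))

theorem mem_invPiSqSpan_iff {d : ℕ} {x : ℝ} :
    x ∈ invPiSqSpan d ↔
      ∃ r : ℕ → ℚ, x = ∑ j ∈ Finset.range (d + 1), (r j : ℝ) * π ^ (-(2 * (j : ℤ))) := by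
  have h : ∀ j : ℕ, π ^ (-(2 * (j : ℤ))) = ((π ^ 2)⁻¹) ^ j := fun j => by
    rw [zpow_neg, zpow_mul, zpow_natCast, inv_pow]; norm_cast
  simp only [h, invPiSqSpan]
  rw [Submodule.mem_span_image_finset_iff_exists_fun']
  simp only [Rat.smul_def, eq_comm]

theorem invPiSqSpan_mono {d e : ℕ} (h : d ≤ e) : invPiSqSpan d ≤ invPiSqSpan e :=
  Submodule.span_mono (Set.image_mono (by
    intro j hj
    simp only [Finset.coe_range, Set.mem_Iio] at hj ⊢
    omega))

theorem ratCast_mul_mem_invPiSqSpan {d : ℕ} {x : ℝ} (q : ℚ) (hx : x ∈ invPiSqSpan d) :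
    (q : ℝ) * x ∈ invPiSqSpan d := by
  rw [← Rat.smul_def]; exact Submodule.smul_mem _ _ hx

theorem ratCast_mem_invPiSqSpan (d : ℕ) (q : ℚ) : (q : ℝ) ∈ invPiSqSpan d := by
  have h : (1 : ℝ) ∈ invPiSqSpan d := Submodule.subset_span ⟨0, by simp, by simp⟩
  simpa using ratCast_mul_mem_invPiSqSpan q h

theorem invPiSq_mul_mem_invPiSqSpan {d : ℕ} {x : ℝ} (hx : x ∈ invPiSqSpan d) :
    (π ^ 2)⁻¹ * x ∈ invPiSqSpan (d + 1) := by
  have h : invPiSqSpan d ≤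
      (invPiSqSpan (d + 1)).comap (LinearMap.mulLeft ℚ ((π ^ 2)⁻¹ : ℝ)) := by
    refine Submodule.span_le.2 ?_
    rintro _ ⟨j, hj, rfl⟩
    refine Submodule.subset_span ⟨j + 1, ?_, ?_⟩
    · simpa using hj
    · exact pow_succ' _ _
  exact h hx

theorem invPiSq_pow_mul_mem_invPiSqSpan {d : ℕ} {x : ℝ} (hx : x ∈ invPiSqSpan d) (e : ℕ) :
    ((π ^ 2)⁻¹) ^ e * x ∈ invPiSqSpan (d + e) := by
  induction e with
  | zero => simpa using hx
  | succ e ih =>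
    rw [pow_succ', mul_assoc]
    exact invPiSq_mul_mem_invPiSqSpan ih

/-- The power of `π` carried by `(∫ cos ^ N)⁻¹`. -/
def parityFactor (N : ℕ) : ℝ := if Even N then π⁻¹ else 1

theorem parityFactor_add_two (N : ℕ) : parityFactor (N + 2) = parityFactor N := by
  simp [parityFactor, Nat.even_add]

theorem parityFactor_add_two_mul (N l : ℕ) : parityFactor (N + 2 * l) = parityFactor N := by
  simp [parityFactor, Nat.even_add]

theorem integral_pow_mul_cos_pow_add_two (n M : ℕ) :
    ∫ x in (-(π / 2))..(π / 2), x ^ n * cos x ^ (M + 2) =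
      (M + 1) / (M + 2) * (∫ x in (-(π / 2))..(π / 2), x ^ n * cos x ^ M) -
      n * (n - 1 : ℕ) / (M + 2) ^ 2 *
        ∫ x in (-(π / 2))..(π / 2), x ^ (n - 2) * cos x ^ (M + 2) := by
  have hderiv : ∀ x ∈ Set.uIcc (-(π / 2)) (π / 2), HasDerivAt
      (fun x : ℝ => x ^ n * (-((M + 2 : ℝ) * (cos x ^ (M + 1) * sin x)))
        - n * (x ^ (n - 1) * cos x ^ (M + 2)))
      ((M + 2) * (M + 1) * (x ^ n * cos x ^ M) - (M + 2) ^ 2 * (x ^ n * cos x ^ (M + 2))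
        - n * (n - 1 : ℕ) * (x ^ (n - 2) * cos x ^ (M + 2))) x := by
    intro x _
    have h1 := hasDerivAt_pow n x
    have h2 := hasDerivAt_pow (n - 1) x
    have h3 := (hasDerivAt_cos x).fun_pow (M + 1)
    have h4 := (hasDerivAt_cos x).fun_pow (M + 2)
    have h := (h1.fun_mul (((h3.fun_mul (hasDerivAt_sin x)).const_mul (M + 2 : ℝ)).fun_neg)).fun_sub
      ((h2.fun_mul h4).const_mul (n : ℝ))
    refine h.congr_deriv ?_
    have hs : sin x ^ 2 = 1 - cos x ^ 2 := sin_sq x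
    rw [show n - 1 - 1 = n - 2 by omega]
    simp only [Nat.add_sub_cancel, show M + 2 - 1 = M + 1 by omega]
    push_cast
    linear_combination (M + 2 : ℝ) * (M + 1) * x ^ n * cos x ^ M * hs
  have hint := intervalIntegral.integral_eq_sub_of_hasDerivAt hderiv
    (Continuous.intervalIntegrable (by fun_prop) _ _)
  rw [intervalIntegral.integral_sub (Continuous.intervalIntegrable (by fun_prop) _ _)
      (Continuous.intervalIntegrable (by fun_prop) _ _),
    intervalIntegral.integral_sub (Continuous.intervalIntegrable (by fun_prop) _ _)
      (Continuous.intervalIntegrable (by fun_prop) _ _)] at hint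
  simp only [intervalIntegral.integral_const_mul] at hint
  simp only [cos_neg, cos_pi_div_two, ne_eq, Nat.add_eq_zero_iff, one_ne_zero, and_false,
    not_false_eq_true, zero_pow, OfNat.ofNat_ne_zero, zero_mul, mul_zero, neg_zero, sub_zero] at hint
  have hM : (M + 2 : ℝ) ≠ 0 := by positivity
  field_simp
  linear_combination -hint

theorem integral_pow_mul_cos (i : ℕ) :
    ∫ x in (-(π / 2))..(π / 2), x ^ (2 * i) * cos x =
      2 * (π / 2) ^ (2 * i) - (2 * i : ℕ) * (2 * i - 1 : ℕ) *
        ∫ x in (-(π / 2))..(π / 2), x ^ (2 * i - 2) * cos x := by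
  have hderiv : ∀ x ∈ Set.uIcc (-(π / 2)) (π / 2), HasDerivAt
      (fun x : ℝ => x ^ (2 * i) * sin x + (2 * i : ℕ) * (x ^ (2 * i - 1) * cos x))
      (x ^ (2 * i) * cos x
        + (2 * i : ℕ) * (2 * i - 1 : ℕ) * (x ^ (2 * i - 2) * cos x)) x := by
    intro x _
    have h := ((hasDerivAt_pow (2 * i) x).fun_mul (hasDerivAt_sin x)).fun_add
      (((hasDerivAt_pow (2 * i - 1) x).fun_mul (hasDerivAt_cos x)).const_mul ((2 * i : ℕ) : ℝ))
    refine h.congr_deriv ?_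
    rw [show 2 * i - 1 - 1 = 2 * i - 2 by omega]
    ring
  have hint := intervalIntegral.integral_eq_sub_of_hasDerivAt hderiv
    (Continuous.intervalIntegrable (by fun_prop) _ _)
  rw [intervalIntegral.integral_add (Continuous.intervalIntegrable (by fun_prop) _ _)
      (Continuous.intervalIntegrable (by fun_prop) _ _)] at hint
  simp only [intervalIntegral.integral_const_mul] at hint
  simp only [cos_neg, cos_pi_div_two, sin_neg, sin_pi_div_two, mul_zero, add_zero,
    (even_two_mul i).neg_pow] at hint
  linear_combination hint

theorem integral_pow_succ_mul_sin_mul_cos_pow (n M : ℕ) :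
    ∫ x in (-(π / 2))..(π / 2), x ^ (n + 1) * (sin x * cos x ^ M) =
      (n + 1) / (M + 1) * ∫ x in (-(π / 2))..(π / 2), x ^ n * cos x ^ (M + 1) := by
  have hderiv : ∀ x ∈ Set.uIcc (-(π / 2)) (π / 2), HasDerivAt
      (fun x : ℝ => x ^ (n + 1) * cos x ^ (M + 1))
      ((n + 1) * (x ^ n * cos x ^ (M + 1)) - (M + 1) * (x ^ (n + 1) * (sin x * cos x ^ M))) x := by
    intro x _
    have h := (hasDerivAt_pow (n + 1) x).fun_mul ((hasDerivAt_cos x).fun_pow (M + 1))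
    refine h.congr_deriv ?_
    simp only [Nat.add_sub_cancel]
    push_cast
    ring
  have hint := intervalIntegral.integral_eq_sub_of_hasDerivAt hderiv
    (Continuous.intervalIntegrable (by fun_prop) _ _)
  rw [intervalIntegral.integral_sub (Continuous.intervalIntegrable (by fun_prop) _ _)
      (Continuous.intervalIntegrable (by fun_prop) _ _)] at hint
  simp only [intervalIntegral.integral_const_mul] at hint
  simp only [cos_neg, cos_pi_div_two, ne_eq, Nat.add_eq_zero_iff, one_ne_zero, and_false,
    not_false_eq_true, zero_pow, mul_zero, sub_zero] at hint
  have hM : (M + 1 : ℝ) ≠ 0 := by positivity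
  rw [div_mul_eq_mul_div, eq_div_iff hM]
  linear_combination -hint

theorem integral_even_pow_mul_cos_pow_mem (M : ℕ) : ∀ i : ℕ,
    parityFactor M * (((π ^ 2)⁻¹) ^ i * ∫ x in (-(π / 2))..(π / 2), x ^ (2 * i) * cos x ^ M)
      ∈ invPiSqSpan i := by
  have hpi : π ≠ 0 := pi_ne_zero
  induction M using Nat.twoStepInduction with
  | zero =>
    intro i
    convert ratCast_mem_invPiSqSpan i (1 / (4 ^ i * (2 * i + 1))) using 1
    have ho : Odd (2 * i + 1) := ⟨i, rfl⟩
    simp only [parityFactor, Even.zero, if_true, pow_zero, mul_one, integral_pow, ho.neg_pow]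
    push_cast
    rw [inv_pow, ← pow_mul, show (4 : ℝ) ^ i = 2 ^ (2 * i) by rw [pow_mul]; norm_num, div_pow]
    field_simp
    ring
  | one =>
    intro i
    simp only [parityFactor, Nat.not_even_one, if_false, one_mul, pow_one]
    induction i with
    | zero =>
      rw [integral_pow_mul_cos]
      simpa using ratCast_mem_invPiSqSpan 0 2
    | succ i ih =>
      rw [integral_pow_mul_cos]
      have h1 := ratCast_mem_invPiSqSpan (i + 1) (2 / 4 ^ (i + 1))
      have h2 := ratCast_mul_mem_invPiSqSpan ((2 * (i + 1) : ℕ) * (2 * (i + 1) - 1 : ℕ))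
        (invPiSq_mul_mem_invPiSqSpan ih)
      convert sub_mem h1 h2 using 1
      rw [show 2 * (i + 1) - 2 = 2 * i by omega, pow_mul (π / 2), div_pow, div_pow, inv_pow]
      push_cast
      norm_num
      field_simp
      ring
  | more M ih _ =>
    intro i
    rw [parityFactor_add_two]
    induction i with
    | zero =>
      rw [integral_pow_mul_cos_pow_add_two]
      convert ratCast_mul_mem_invPiSqSpan ((M + 1) / (M + 2)) (ih 0) using 1
      push_cast
      ring
    | succ i ihi =>
      rw [integral_pow_mul_cos_pow_add_two]
      have h1 := ratCast_mul_mem_invPiSqSpan ((M + 1) / (M + 2)) (ih (i + 1))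
      have h2 := ratCast_mul_mem_invPiSqSpan
        ((2 * (i + 1) : ℕ) * (2 * (i + 1) - 1 : ℕ) / (M + 2) ^ 2)
        (invPiSq_mul_mem_invPiSqSpan ihi)
      convert sub_mem h1 h2 using 1
      rw [show 2 * (i + 1) - 2 = 2 * i by omega]
      push_cast
      ring

theorem continuous_aeval_cos_sq (R : Polynomial ℚ) :
    Continuous fun x : ℝ => Polynomial.aeval (cos x ^ 2) R :=
  R.continuous_aeval.comp (by fun_prop)

theorem integral_even_pow_mul_aeval_cos_sq_mem (N i : ℕ) (R : Polynomial ℚ) :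
    parityFactor N * (((π ^ 2)⁻¹) ^ i * ∫ x in (-(π / 2))..(π / 2),
      cos x ^ N * (x ^ (2 * i) * Polynomial.aeval (cos x ^ 2) R)) ∈ invPiSqSpan i := by
  induction R using Polynomial.induction_on' with
  | add p q hp hq =>
    have := continuous_aeval_cos_sq p
    have := continuous_aeval_cos_sq q
    simp only [map_add, mul_add]
    rw [intervalIntegral.integral_add (Continuous.intervalIntegrable (by fun_prop) _ _)
      (Continuous.intervalIntegrable (by fun_prop) _ _), mul_add, mul_add]
    exact add_mem hp hq
  | monomial l a =>
    have h := ratCast_mul_mem_invPiSqSpan a (integral_even_pow_mul_cos_pow_mem (N + 2 * l) i)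
    rw [parityFactor_add_two_mul] at h
    convert h using 1
    rw [show (fun x : ℝ => cos x ^ N * (x ^ (2 * i) *
        Polynomial.aeval (cos x ^ 2) (Polynomial.monomial l a))) =
        fun x => (a : ℝ) * (x ^ (2 * i) * cos x ^ (N + 2 * l)) by
      funext x
      rw [Polynomial.aeval_monomial, eq_ratCast]
      ring, intervalIntegral.integral_const_mul]
    ring

theorem integral_odd_pow_mul_aeval_cos_sq_mem (N i : ℕ) (R : Polynomial ℚ) :
    parityFactor N * (((π ^ 2)⁻¹) ^ i * ∫ x in (-(π / 2))..(π / 2),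
      cos x ^ N * (x ^ (2 * i + 1) * (sin x * cos x * Polynomial.aeval (cos x ^ 2) R)))
      ∈ invPiSqSpan i := by
  induction R using Polynomial.induction_on' with
  | add p q hp hq =>
    have := continuous_aeval_cos_sq p
    have := continuous_aeval_cos_sq q
    simp only [map_add, mul_add]
    rw [intervalIntegral.integral_add (Continuous.intervalIntegrable (by fun_prop) _ _)
      (Continuous.intervalIntegrable (by fun_prop) _ _), mul_add, mul_add]
    exact add_mem hp hq
  | monomial l a =>
    have h := ratCast_mul_mem_invPiSqSpan (a * ((2 * i + 1) / (N + 2 * l + 2)))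
      (integral_even_pow_mul_cos_pow_mem (N + 2 * (l + 1)) i)
    rw [parityFactor_add_two_mul] at h
    convert h using 1
    rw [show (fun x : ℝ => cos x ^ N * (x ^ (2 * i + 1) * (sin x * cos x *
        Polynomial.aeval (cos x ^ 2) (Polynomial.monomial l a)))) =
        fun x => (a : ℝ) * (x ^ (2 * i + 1) * (sin x * cos x ^ (N + 2 * l + 1))) by
      funext x
      rw [Polynomial.aeval_monomial, eq_ratCast]
      ring, intervalIntegral.integral_const_mul, integral_pow_succ_mul_sin_mul_cos_pow]
    rw [show N + 2 * (l + 1) = N + 2 * l + 1 + 1 by ring]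
    push_cast
    ring

theorem integral_eq_zero_of_odd {f : ℝ → ℝ} (hf : ∀ x, f (-x) = -f x) (a : ℝ) :
    ∫ x in (-a)..a, f x = 0 := by
  have h := intervalIntegral.integral_comp_neg (a := -a) (b := a) f
  simp only [hf, intervalIntegral.integral_neg, neg_neg] at h
  linarith

/-- Only the even powers of an odd function `H` contribute to `∫ cos ^ N * (1/2 + H) ^ m`. -/
theorem integral_cos_pow_mul_half_add_pow_mem (N m d : ℕ) {H : ℝ → ℝ} (hc : Continuous H)
    (hodd : ∀ x, H (-x) = -H x)
    (hH : ∀ e, 2 * e ≤ m → parityFactor N *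
      (∫ x in (-(π / 2))..(π / 2), cos x ^ N * H x ^ (2 * e)) ∈ invPiSqSpan d) :
    parityFactor N * (∫ x in (-(π / 2))..(π / 2), cos x ^ N * (1 / 2 + H x) ^ m)
      ∈ invPiSqSpan d := by
  have hexp : ∀ x, cos x ^ N * (1 / 2 + H x) ^ m = ∑ j ∈ Finset.range (m + 1),
      ((1 / 2 : ℝ) ^ (m - j) * m.choose j) * (cos x ^ N * H x ^ j) := fun x => by
    rw [add_comm, add_pow, Finset.mul_sum]
    exact Finset.sum_congr rfl fun j _ => by ring
  simp only [hexp]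
  rw [intervalIntegral.integral_finsetSum
    fun j _ => Continuous.intervalIntegrable (by fun_prop) _ _, Finset.mul_sum]
  refine Submodule.sum_mem _ fun j hj => ?_
  rw [intervalIntegral.integral_const_mul]
  rcases Nat.even_or_odd' j with ⟨e, rfl | rfl⟩
  · convert ratCast_mul_mem_invPiSqSpan ((1 / 2) ^ (m - 2 * e) * m.choose (2 * e))
      (hH e (by simpa [Nat.lt_succ_iff] using hj)) using 1
    push_cast
    ring
  · rw [integral_eq_zero_of_odd fun x => by
      rw [cos_neg, hodd, Odd.neg_pow ⟨e, rfl⟩, mul_neg]]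
    simp

theorem integral_cos_pow_mul_sin_pow_mem (N e : ℕ) (Q : Polynomial ℚ) :
    parityFactor N * (∫ x in (-(π / 2))..(π / 2),
      cos x ^ N * (sin x * Polynomial.aeval (cos x ^ 2) Q) ^ (2 * e)) ∈ invPiSqSpan 0 := by
  convert integral_even_pow_mul_aeval_cos_sq_mem N 0 (((1 - Polynomial.X) * Q ^ 2) ^ e) using 2
  rw [pow_zero, one_mul]
  congr 1
  funext x
  simp only [map_pow, map_mul, map_sub, map_one, Polynomial.aeval_X, ← sin_sq]
  ring

theorem integral_cos_pow_mul_angle_pow_mem (N e : ℕ) (Q : Polynomial ℚ) :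
    parityFactor N * (∫ x in (-(π / 2))..(π / 2), cos x ^ N *
      (π⁻¹ * (x + sin x * cos x * Polynomial.aeval (cos x ^ 2) Q)) ^ (2 * e))
      ∈ invPiSqSpan e := by
  have hQ := continuous_aeval_cos_sq Q
  have hexp : ∀ x, cos x ^ N *
      (π⁻¹ * (x + sin x * cos x * Polynomial.aeval (cos x ^ 2) Q)) ^ (2 * e) =
      ∑ j ∈ Finset.range (2 * e + 1), (((π ^ 2)⁻¹) ^ e * (2 * e).choose j) *
        (cos x ^ N * (x ^ j *
          (sin x * cos x * Polynomial.aeval (cos x ^ 2) Q) ^ (2 * e - j))) := fun x => by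
    rw [mul_pow, add_pow, Finset.mul_sum, Finset.mul_sum, pow_mul, inv_pow]
    exact Finset.sum_congr rfl fun j _ => by ring
  simp only [hexp]
  rw [intervalIntegral.integral_finsetSum
    fun j _ => Continuous.intervalIntegrable (by fun_prop) _ _, Finset.mul_sum]
  refine Submodule.sum_mem _ fun j hj => ?_
  rw [intervalIntegral.integral_const_mul]
  have hj' : j < 2 * e + 1 := by simpa using hj
  rcases Nat.even_or_odd' j with ⟨i, rfl | rfl⟩
  · obtain ⟨t, rfl⟩ : ∃ t, e = i + t := ⟨e - i, by omega⟩
    have h := ratCast_mul_mem_invPiSqSpan ((2 * (i + t)).choose (2 * i))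
      (invPiSq_pow_mul_mem_invPiSqSpan (integral_even_pow_mul_aeval_cos_sq_mem N i
        (((1 - Polynomial.X) * Polynomial.X * Q ^ 2) ^ t)) t)
    convert h using 1
    rw [show (fun x : ℝ => cos x ^ N * (x ^ (2 * i) *
        Polynomial.aeval (cos x ^ 2) (((1 - Polynomial.X) * Polynomial.X * Q ^ 2) ^ t))) =
        fun x => cos x ^ N * (x ^ (2 * i) * (sin x * cos x *
          Polynomial.aeval (cos x ^ 2) Q) ^ (2 * (i + t) - 2 * i)) by
      funext x
      simp only [map_pow, map_mul, map_sub, map_one, Polynomial.aeval_X, ← sin_sq]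
      rw [show 2 * (i + t) - 2 * i = 2 * t by omega]
      ring]
    push_cast
    ring
  · obtain ⟨t, rfl⟩ : ∃ t, e = i + (t + 1) := ⟨e - i - 1, by omega⟩
    have h := ratCast_mul_mem_invPiSqSpan ((2 * (i + (t + 1))).choose (2 * i + 1))
      (invPiSq_pow_mul_mem_invPiSqSpan (integral_odd_pow_mul_aeval_cos_sq_mem N i
        (((1 - Polynomial.X) * Polynomial.X * Q ^ 2) ^ t * Q)) (t + 1))
    convert h using 1
    rw [show (fun x : ℝ => cos x ^ N * (x ^ (2 * i + 1) * (sin x * cos x *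
        Polynomial.aeval (cos x ^ 2) (((1 - Polynomial.X) * Polynomial.X * Q ^ 2) ^ t * Q)))) =
        fun x => cos x ^ N * (x ^ (2 * i + 1) * (sin x * cos x *
          Polynomial.aeval (cos x ^ 2) Q) ^ (2 * (i + (t + 1)) - (2 * i + 1))) by
      funext x
      simp only [map_pow, map_mul, map_sub, map_one, Polynomial.aeval_X, ← sin_sq]
      rw [show 2 * (i + (t + 1)) - (2 * i + 1) = 2 * t + 1 by omega]
      ring]
    push_cast
    ring

theorem c1t_add_one {β : ℝ} (hβ : 1 / 2 < β) : c1t (β + 1) = c1t β * (β / (β - 1 / 2)) := by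
  have h1 : β ≠ 0 := by linarith
  have h2 : β - 1 / 2 ≠ 0 := by linarith
  have h3 : Gamma (β - 1 / 2) ≠ 0 := (Gamma_pos_of_pos (by linarith)).ne'
  have h4 : √π ≠ 0 := (sqrt_pos.2 pi_pos).ne'
  rw [c1t, c1t, show β + 1 - 1 / 2 = β - 1 / 2 + 1 by ring, Gamma_add_one h1, Gamma_add_one h2]
  field_simp

theorem c1t_one : c1t 1 = π⁻¹ := by
  rw [c1t, show (1 : ℝ) - 1 / 2 = 1 / 2 by norm_num, Gamma_one_half_eq, Gamma_one,
    mul_self_sqrt pi_pos.le, one_div]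

theorem c1t_three_halves : c1t (3 / 2) = 1 / 2 := by
  have h4 : √π ≠ 0 := (sqrt_pos.2 pi_pos).ne'
  rw [c1t, show (3 / 2 : ℝ) - 1 / 2 = 1 by norm_num, Gamma_one,
    show (3 / 2 : ℝ) = 1 / 2 + 1 by norm_num, Gamma_add_one (by norm_num), Gamma_one_half_eq]
  field_simp

theorem c1t_nat_add_two (M : ℕ) :
    c1t (((M + 2 : ℕ) + 2) / 2) = c1t ((M + 2) / 2) * ((M + 2) / (M + 1)) := by
  have hM : (0 : ℝ) ≤ M := M.cast_nonneg
  have h := c1t_add_one (β := (M + 2) / 2) (by linarith)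
  rw [show (((M + 2 : ℕ) : ℝ) + 2) / 2 = (M + 2) / 2 + 1 by push_cast; ring, h]
  congr 1
  have h1 : (M + 1 : ℝ) ≠ 0 := by positivity
  rw [show ((M : ℝ) + 2) / 2 - 1 / 2 = (M + 1) / 2 by ring]
  field_simp

theorem exists_c1t_eq_ratCast_mul_parityFactor (M : ℕ) :
    ∃ q : ℚ, c1t ((M + 2) / 2) = q * parityFactor M := by
  induction M using Nat.twoStepInduction with
  | zero => exact ⟨1, by simp [c1t_one, parityFactor]⟩
  | one => exact ⟨1 / 2, by norm_num [c1t_three_halves, parityFactor]⟩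
  | more M ih _ =>
    obtain ⟨q, hq⟩ := ih
    refine ⟨q * ((M + 2) / (M + 1)), ?_⟩
    rw [c1t_nat_add_two, hq, parityFactor_add_two]
    push_cast
    ring

/-- The distribution function of the density `c1t ((M + 2) / 2) * cos ^ M`. -/
def cosPowCdf (M : ℕ) (x : ℝ) : ℝ :=
  ∫ θ in (-(π / 2))..x, c1t ((M + 2) / 2) * cos θ ^ M

theorem cosPowCdf_add_two (M : ℕ) (x : ℝ) :
    cosPowCdf (M + 2) x =
      cosPowCdf M x + c1t ((M + 2) / 2) / (M + 1) * (cos x ^ (M + 1) * sin x) := by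
  have h1 : (M + 1 : ℝ) ≠ 0 := by positivity
  have h2 : (M + 2 : ℝ) ≠ 0 := by positivity
  simp only [cosPowCdf, intervalIntegral.integral_const_mul, c1t_nat_add_two, integral_cos_pow]
  simp only [cos_neg, cos_pi_div_two, ne_eq, Nat.add_eq_zero_iff, one_ne_zero, and_false,
    not_false_eq_true, zero_pow, zero_mul, sub_zero]
  field_simp
  ring

theorem exists_cosPowCdf_odd (p : ℕ) : ∃ Q : Polynomial ℚ, ∀ x,
    cosPowCdf (2 * p + 1) x = 1 / 2 + sin x * Polynomial.aeval (cos x ^ 2) Q := by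
  induction p with
  | zero =>
    refine ⟨Polynomial.C (1 / 2), fun x => ?_⟩
    simp only [cosPowCdf, intervalIntegral.integral_const_mul]
    norm_num [c1t_three_halves]
    ring
  | succ p ih =>
    obtain ⟨Q, hQ⟩ := ih
    obtain ⟨q, hq⟩ := exists_c1t_eq_ratCast_mul_parityFactor (2 * p + 1)
    refine ⟨Q + Polynomial.C (q / (2 * p + 2)) * Polynomial.X ^ (p + 1), fun x => ?_⟩
    rw [show 2 * (p + 1) + 1 = 2 * p + 1 + 2 by ring, cosPowCdf_add_two, hQ, hq]
    simp only [parityFactor, Nat.not_even_two_mul_add_one, if_false, map_add, map_mul, map_pow,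
      Polynomial.aeval_X, Polynomial.aeval_C, eq_ratCast]
    push_cast
    ring

theorem exists_cosPowCdf_even (p : ℕ) : ∃ Q : Polynomial ℚ, ∀ x,
    cosPowCdf (2 * p) x =
      1 / 2 + π⁻¹ * (x + sin x * cos x * Polynomial.aeval (cos x ^ 2) Q) := by
  induction p with
  | zero =>
    refine ⟨0, fun x => ?_⟩
    have := pi_ne_zero
    simp only [cosPowCdf, intervalIntegral.integral_const_mul]
    norm_num [c1t_one]
    field_simp
    ring
  | succ p ih =>
    obtain ⟨Q, hQ⟩ := ih
    obtain ⟨q, hq⟩ := exists_c1t_eq_ratCast_mul_parityFactor (2 * p)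
    refine ⟨Q + Polynomial.C (q / (2 * p + 1)) * Polynomial.X ^ p, fun x => ?_⟩
    rw [show 2 * (p + 1) = 2 * p + 2 by ring, cosPowCdf_add_two, hQ, hq]
    simp only [parityFactor, even_two_mul, if_true, map_add, map_mul, map_pow,
      Polynomial.aeval_X, Polynomial.aeval_C, eq_ratCast]
    push_cast
    ring

theorem It_natCast_eq {α k : ℕ} (hα : 0 < α) (hk : 1 ≤ k) (n : ℕ) :
    It n k (α : ℝ) = c1t (((α * k - 1 : ℕ) + 2) / 2) *
      ∫ x in (-(π / 2))..(π / 2), cos x ^ (α * k - 1) * cosPowCdf (α - 1) x ^ (n - k) := by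
  have h1 : ((α * k - 1 : ℕ) : ℝ) = α * k - 1 := by
    rw [Nat.cast_sub (Nat.mul_pos hα hk)]; push_cast; rfl
  have h2 : ((α - 1 : ℕ) : ℝ) = α - 1 := by
    rw [Nat.cast_sub hα]; push_cast; rfl
  rw [← intervalIntegral.integral_const_mul]
  simp only [It, cosPowCdf, ← rpow_natCast _ (α * k - 1), ← rpow_natCast _ (α - 1), h1, h2]
  ring_nf

theorem Itb_mem_invPiSqSpan {α k : ℕ} (hα : 0 < α) (hk : 1 ≤ k) (n : ℕ) {d : ℕ}
    (h : parityFactor (α * k - 1) * (∫ x in (-(π / 2))..(π / 2),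
      cos x ^ (α * k - 1) * cosPowCdf (α - 1) x ^ (n - k)) ∈ invPiSqSpan d) :
    Itb n k (α : ℝ) ∈ invPiSqSpan d := by
  obtain ⟨q, hq⟩ := exists_c1t_eq_ratCast_mul_parityFactor (α * k - 1)
  convert ratCast_mul_mem_invPiSqSpan (n.choose k * q) h using 1
  rw [Itb, It_natCast_eq hα hk, hq]
  push_cast
  ring

theorem Itb_mem_invPiSqSpan_of_even {α k : ℕ} (hα : 0 < α) (hk : 1 ≤ k) (n : ℕ) (he : Even α) :
    Itb n k (α : ℝ) ∈ invPiSqSpan 0 := by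
  obtain ⟨p, hp⟩ : ∃ p, α - 1 = 2 * p + 1 := by
    obtain ⟨a, rfl⟩ := he
    exact ⟨a - 1, by omega⟩
  obtain ⟨Q, hQ⟩ := exists_cosPowCdf_odd p
  have hc := continuous_aeval_cos_sq Q
  apply Itb_mem_invPiSqSpan hα hk
  simp only [hp, hQ]
  exact integral_cos_pow_mul_half_add_pow_mem _ _ _ (by fun_prop) (fun x => by simp)
    fun e _ => integral_cos_pow_mul_sin_pow_mem _ e Q

theorem Itb_mem_invPiSqSpan_of_odd {α k : ℕ} (hα : 0 < α) (hk : 1 ≤ k) (n : ℕ) (ho : Odd α) :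
    Itb n k (α : ℝ) ∈ invPiSqSpan ((n - k) / 2) := by
  obtain ⟨p, rfl⟩ := ho
  obtain ⟨Q, hQ⟩ := exists_cosPowCdf_even p
  have hc := continuous_aeval_cos_sq Q
  apply Itb_mem_invPiSqSpan hα hk
  simp only [Nat.add_sub_cancel, hQ]
  exact integral_cos_pow_mul_half_add_pow_mem _ _ _ (by fun_prop)
    (fun x => by simp only [sin_neg, cos_neg]; ring)
    fun e he => invPiSqSpan_mono (by omega) (integral_cos_pow_mul_angle_pow_mem _ e Q)

theorem Itb_arithmetic (α : ℕ) (hα : 0 < α) (n k : ℕ) (hk1 : 1 ≤ k) (hk2 : k ≤ n) :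
    (Even α → ∃ q : ℚ, Itb n k (α : ℝ) = (q : ℝ)) ∧
    (Odd α →
      (Even (n - k) → ∃ r : ℕ → ℚ,
        Itb n k (α : ℝ) =
          ∑ j ∈ Finset.range ((n - k) / 2 + 1), (r j : ℝ) * Real.pi ^ (-(2 * (j : ℤ)))) ∧
      (¬ Even (n - k) → ∃ r : ℕ → ℚ,
        Itb n k (α : ℝ) =
          ∑ j ∈ Finset.range ((n - k - 1) / 2 + 1),
            (r j : ℝ) * Real.pi ^ (-(2 * (j : ℤ))))) := by
  refine ⟨fun he => ?_, fun ho => ?_⟩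
  · obtain ⟨r, hr⟩ := mem_invPiSqSpan_iff.1 (Itb_mem_invPiSqSpan_of_even hα hk1 n he)
    exact ⟨r 0, by simpa using hr⟩
  · have h := Itb_mem_invPiSqSpan_of_odd hα hk1 n ho
    refine ⟨fun _ => mem_invPiSqSpan_iff.1 h, fun hodd => mem_invPiSqSpan_iff.1 ?_⟩
    obtain ⟨t, ht⟩ := Nat.not_even_iff_odd.1 hodd
    rwa [show (n - k - 1) / 2 = (n - k) / 2 by omega]

end
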